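/- Let G = (V, E) be a finite simple graph with maximum degree Δ ≥ 2, and construct the approval profile with candidate set C = {c_v : v ∈ V} ∪ {d_{v,j} : v ∈ V, 1 ≤ j ≤ Δ − deg(v)}, one agent with ballot {c_u, c_v} for each edge {u, v} ∈ E, and one agent with ballot {c_v, d_{v,j}} for each v ∈ V and 1 ≤ j ≤ Δ − deg(v). Then for a committee W ⊆ C and a candidate c ∈ C \ W, the marginal increase PAV(W ∪ {c}) − PAV(W) equals Δ if and only if c = c_v for some vertex v ∈ V and the ballot of every agent approving c is disjoint from W; in particular, equality implies that no candidate c_u with u adjacent to v in G belongs to W. -/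

import Mathlib

open Finset

/-- The harmonic number `H(p) = 1 + 1/2 + ⋯ + 1/p`, with `H(0) = 0`. -/
def harm (p : ℕ) : ℚ := ∑ j ∈ Finset.range p, (1 : ℚ) / (j + 1)

/-- The PAV score of a committee `W` under the approval profile `A`. -/
def pavScore {C I : Type*} [Fintype I] [DecidableEq C] (A : I → Finset C) (W : Finset C) : ℚ :=
  ∑ i, harm ((W ∩ A i).card)

variable {V : Type*} [Fintype V] [DecidableEq V]

/-- Candidates: one candidate `c_v` for each vertex `v` (left summand) and
`Δ - deg v` dummy candidates `d_{v,j}` for each vertex `v` (right summand). -/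
abbrev PavCand (G : SimpleGraph V) [DecidableRel G.Adj] : Type _ :=
  V ⊕ (Σ v : V, Fin (G.maxDegree - G.degree v))

/-- Agents: one agent per edge of `G` (left summand) and one agent per dummy
candidate `d_{v,j}` (right summand). -/
abbrev PavAgent (G : SimpleGraph V) [DecidableRel G.Adj] : Type _ :=
  {e : Sym2 V // e ∈ G.edgeFinset} ⊕ (Σ v : V, Fin (G.maxDegree - G.degree v))

/-- The ballots: the agent of edge `{u,v}` approves `{c_u, c_v}`; the agent of
dummy candidate `d_{v,j}` approves `{c_v, d_{v,j}}`. -/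
def pavBallot (G : SimpleGraph V) [DecidableRel G.Adj] : PavAgent G → Finset (PavCand G)
  | Sum.inl e =>
      Sym2.lift ⟨fun u v => ({Sum.inl u, Sum.inl v} : Finset (PavCand G)),
        fun u v => Finset.pair_comm _ _⟩ e.1
  | Sum.inr ⟨v, j⟩ => {Sum.inl v, Sum.inr ⟨v, j⟩}

theorem harm_succ (p : ℕ) : harm (p + 1) = harm p + 1 / ((p : ℚ) + 1) :=
  Finset.sum_range_succ _ _

theorem pavScore_insert_sub {C I : Type*} [Fintype I] [DecidableEq C] (A : I → Finset C)
    {W : Finset C} {c : C} (hc : c ∉ W) :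
    pavScore A (insert c W) - pavScore A W =
      ∑ i with c ∈ A i, 1 / (((W ∩ A i).card : ℚ) + 1) := by
  rw [pavScore, pavScore, ← Finset.sum_sub_distrib, Finset.sum_filter]
  refine Finset.sum_congr rfl fun i _ => ?_
  split_ifs with h
  · rw [Finset.insert_inter_of_mem h, Finset.card_insert_of_notMem (by simp [hc]), harm_succ]
    ring
  · rw [Finset.insert_inter_of_notMem h, sub_self]

theorem one_div_card_inter_add_one_le_one {C : Type*} [DecidableEq C] (S W : Finset C) :
    1 / (((W ∩ S).card : ℚ) + 1) ≤ 1 :=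
  div_le_one_of_le₀ (by simp) (by positivity)

theorem pavScore_insert_sub_le {C I : Type*} [Fintype I] [DecidableEq C] (A : I → Finset C)
    {W : Finset C} {c : C} (hc : c ∉ W) :
    pavScore A (insert c W) - pavScore A W ≤ (({i | c ∈ A i} : Finset I).card : ℚ) := by
  rw [pavScore_insert_sub A hc, Finset.cast_card]
  exact Finset.sum_le_sum fun i _ => one_div_card_inter_add_one_le_one _ _

theorem pavScore_insert_sub_eq_card_iff {C I : Type*} [Fintype I] [DecidableEq C]
    (A : I → Finset C) {W : Finset C} {c : C} (hc : c ∉ W) :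
    pavScore A (insert c W) - pavScore A W = (({i | c ∈ A i} : Finset I).card : ℚ) ↔
      ∀ i, c ∈ A i → Disjoint (A i) W := by
  rw [pavScore_insert_sub A hc, Finset.cast_card,
    Finset.sum_eq_sum_iff_of_le fun i _ => one_div_card_inter_add_one_le_one _ _]
  simp only [Finset.mem_filter, Finset.mem_univ, true_and]
  refine forall₂_congr fun i _ => ?_
  rw [disjoint_comm, Finset.disjoint_iff_inter_eq_empty, ← Finset.card_eq_zero,
    div_eq_one_iff_eq (by positivity)]
  constructor
  · intro h
    exact_mod_cast (by linarith : ((W ∩ A i).card : ℚ) = 0)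
  · intro h
    simp [h]

theorem inl_mem_pavBallot_inl (G : SimpleGraph V) [DecidableRel G.Adj] (v : V)
    (e : {e : Sym2 V // e ∈ G.edgeFinset}) :
    (Sum.inl v : PavCand G) ∈ pavBallot G (Sum.inl e) ↔ v ∈ e.1 := by
  obtain ⟨e, he⟩ := e
  induction e using Sym2.ind with
  | _ x y => simp [pavBallot]

theorem inr_notMem_pavBallot_inl (G : SimpleGraph V) [DecidableRel G.Adj]
    (d : Σ v : V, Fin (G.maxDegree - G.degree v)) (e : {e : Sym2 V // e ∈ G.edgeFinset}) :
    (Sum.inr d : PavCand G) ∉ pavBallot G (Sum.inl e) := by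
  obtain ⟨e, he⟩ := e
  induction e using Sym2.ind with
  | _ x y => simp [pavBallot]

theorem inl_mem_pavBallot_inr (G : SimpleGraph V) [DecidableRel G.Adj] (v : V)
    (d : Σ v : V, Fin (G.maxDegree - G.degree v)) :
    (Sum.inl v : PavCand G) ∈ pavBallot G (Sum.inr d) ↔ v = d.1 := by
  simp [pavBallot]

theorem inr_mem_pavBallot_inr (G : SimpleGraph V) [DecidableRel G.Adj]
    (d d' : Σ v : V, Fin (G.maxDegree - G.degree v)) :
    (Sum.inr d : PavCand G) ∈ pavBallot G (Sum.inr d') ↔ d = d' := by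
  simp [pavBallot]

theorem card_approving_vertex (G : SimpleGraph V) [DecidableRel G.Adj] (v : V) :
    ({i | Sum.inl v ∈ pavBallot G i} : Finset (PavAgent G)).card = G.maxDegree := by
  have hedge : ∑ e : {e : Sym2 V // e ∈ G.edgeFinset}, (if v ∈ e.1 then 1 else 0) =
      G.degree v := by
    rw [Finset.sum_coe_sort G.edgeFinset fun e => if v ∈ e then 1 else 0, ← Finset.card_filter,
      ← G.card_incidenceFinset_eq_degree, G.incidenceFinset_eq_filter]
  rw [Finset.card_filter, Fintype.sum_sum_type]
  simp only [inl_mem_pavBallot_inl, inl_mem_pavBallot_inr, hedge, Fintype.sum_sigma]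
  simp [apply_ite Finset.card, G.degree_le_maxDegree v]

theorem card_approving_dummy (G : SimpleGraph V) [DecidableRel G.Adj]
    (d : Σ v : V, Fin (G.maxDegree - G.degree v)) :
    ({i | Sum.inr d ∈ pavBallot G i} : Finset (PavAgent G)).card = 1 := by
  rw [Finset.card_filter, Fintype.sum_sum_type]
  simp only [inr_notMem_pavBallot_inl, inr_mem_pavBallot_inr]
  simp

/-- In the PAV instance constructed from the graph `G`, the marginal increase of
adding a candidate `c ∉ W` to a committee `W` equals `Δ` iff `c` is a vertex
candidate `c_v` whose approving agents all have ballots disjoint from `W`; in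
particular, equality implies that no candidate `c_u` with `u` adjacent to `v`
belongs to `W`. -/
theorem pav_marginal_increase_eq_maxDegree_iff
    (G : SimpleGraph V) [DecidableRel G.Adj] (hΔ : 2 ≤ G.maxDegree)
    (W : Finset (PavCand G)) (c : PavCand G) (hc : c ∉ W) :
    ((pavScore (pavBallot G) (insert c W) - pavScore (pavBallot G) W = (G.maxDegree : ℚ)) ↔
      (∃ v : V, c = Sum.inl v ∧
        ∀ i : PavAgent G, c ∈ pavBallot G i → Disjoint (pavBallot G i) W)) ∧
    ((pavScore (pavBallot G) (insert c W) - pavScore (pavBallot G) W = (G.maxDegree : ℚ)) →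
      ∀ v : V, c = Sum.inl v → ∀ u : V, G.Adj u v → (Sum.inl u : PavCand G) ∉ W) := by
  have key : pavScore (pavBallot G) (insert c W) - pavScore (pavBallot G) W = (G.maxDegree : ℚ) ↔
      ∃ v : V, c = Sum.inl v ∧
        ∀ i : PavAgent G, c ∈ pavBallot G i → Disjoint (pavBallot G i) W := by
    rcases c with v | d
    · have h := pavScore_insert_sub_eq_card_iff (pavBallot G) hc
      rw [card_approving_vertex] at h
      simp [h]
    · have h := pavScore_insert_sub_le (pavBallot G) hc
      rw [card_approving_dummy, Nat.cast_one] at h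
      have hΔ' : (2 : ℚ) ≤ G.maxDegree := by exact_mod_cast hΔ
      simp only [reduceCtorEq, false_and, exists_false, iff_false]
      intro heq
      linarith
  refine ⟨key, fun heq v hv u huv => ?_⟩
  obtain ⟨-, -, hdisj⟩ := key.1 heq
  subst hv
  let e : {e : Sym2 V // e ∈ G.edgeFinset} := ⟨s(u, v), by simpa using huv⟩
  exact Finset.disjoint_left.1
    (hdisj (Sum.inl e) ((inl_mem_pavBallot_inl G v e).2 (Sym2.mem_mk_right u v)))
    ((inl_mem_pavBallot_inl G u e).2 (Sym2.mem_mk_left u v))
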